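/- De-aliasing bound for the 2/3 method: if S is a smoothing operator acting only on modes |k| ≤ 2N/3 (with factors σ_k ∈ (0,1]) and q ∈ C^r with r ≥ 1, then |∫ (S u_N) ∂_x A_N[q (S u_N)] dx| ≤ C ‖q‖_{C^r} N^{1−r} ‖S u_N‖_{L^2}^2. -/

import Mathlib

/-- The `k`-th Fourier coefficient of a `2π`-periodic function `f : ℝ → ℂ`. -/
noncomputable def fc (f : ℝ → ℂ) (k : ℤ) : ℂ :=
  (1 / (2 * Real.pi)) • ∫ x in (0 : ℝ)..(2 * Real.pi),
    f x * Complex.exp (-(Complex.I * (k : ℂ) * (x : ℂ)))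

/-- The spectral Fourier projection `S_N f (x) = Σ_{|k|≤N} f̂(k) e^{ikx}`. -/
noncomputable def SN (N : ℕ) (f : ℝ → ℂ) (x : ℝ) : ℂ :=
  ∑ k ∈ Finset.Icc (-(N : ℤ)) (N : ℤ), fc f k * Complex.exp (Complex.I * (k : ℂ) * (x : ℂ))

/-- `f` is a trigonometric polynomial of degree at most `N`. -/
def IsTrigPoly (N : ℕ) (f : ℝ → ℂ) : Prop :=
  ∃ c : ℤ → ℂ, ∀ x : ℝ,
    f x = ∑ k ∈ Finset.Icc (-(N : ℤ)) (N : ℤ), c k * Complex.exp (Complex.I * (k : ℂ) * (x : ℂ))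

/-- The `k`-th Fourier coefficient of the aliasing error `A_N[f]`: `Σ_{ℓ≠0} f̂(k+ℓ(2N+1))`. -/
noncomputable def aliasC (N : ℕ) (f : ℝ → ℂ) (k : ℤ) : ℂ :=
  ∑' l : ℤ, if l ≠ 0 then fc f (k + l * (2 * (N : ℤ) + 1)) else 0

/-- The aliasing operator `A_N[f](x) = Σ_{|k|≤N} (Σ_{ℓ≠0} f̂(k+ℓ(2N+1))) e^{ikx}`. -/
noncomputable def AN (N : ℕ) (f : ℝ → ℂ) (x : ℝ) : ℂ :=
  ∑ k ∈ Finset.Icc (-(N : ℤ)) (N : ℤ), aliasC N f k * Complex.exp (Complex.I * (k : ℂ) * (x : ℂ))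

open MeasureTheory Filter Topology

/-- Exponential mode. -/
noncomputable def ee (k : ℤ) (x : ℝ) : ℂ := Complex.exp (Complex.I * (k : ℂ) * (x : ℂ))

/-- Trigonometric sum. -/
noncomputable def tp (s : Finset ℤ) (c : ℤ → ℂ) (x : ℝ) : ℂ := ∑ k ∈ s, c k * ee k x

lemma ee_cont (k : ℤ) : Continuous (ee k) := by unfold ee; fun_prop

lemma tp_cont (s c) : Continuous (tp s c) := by
  unfold tp
  exact continuous_finsetSum _ fun k _ => continuous_const.mul (ee_cont k)

lemma ee_contDiff (k : ℤ) (n : WithTop ℕ∞) : ContDiff ℝ n (ee k) := by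
  unfold ee
  apply ContDiff.cexp
  apply ContDiff.mul contDiff_const
  exact Complex.ofRealCLM.contDiff

lemma tp_contDiff (s c) (n : WithTop ℕ∞) : ContDiff ℝ n (tp s c) := by
  unfold tp
  exact ContDiff.sum fun k _ => contDiff_const.mul (ee_contDiff k n)

lemma ee_add (j k : ℤ) (x : ℝ) : ee (j + k) x = ee j x * ee k x := by
  unfold ee; rw [← Complex.exp_add]; congr 1; push_cast; ring

lemma ee_addx (k : ℤ) (x y : ℝ) : ee k (x + y) = ee k x * ee k y := by
  unfold ee; rw [← Complex.exp_add]; congr 1; push_cast; ring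

lemma ee_neg (k : ℤ) (x : ℝ) : Complex.exp (-(Complex.I * (k : ℂ) * (x : ℂ))) = ee (-k) x := by
  unfold ee; congr 1; push_cast; ring

lemma ee_zero (x : ℝ) : ee 0 x = 1 := by simp [ee]

lemma ee_norm (k : ℤ) (x : ℝ) : ‖ee k x‖ = 1 := by
  unfold ee
  rw [show Complex.I * (k : ℂ) * (x : ℂ) = ((k * x : ℝ) : ℂ) * Complex.I by push_cast; ring]
  exact Complex.norm_exp_ofReal_mul_I _

lemma ee_conj (k : ℤ) (x : ℝ) : (starRingEnd ℂ) (ee k x) = ee (-k) x := by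
  unfold ee; rw [← Complex.exp_conj]; congr 1; simp

lemma ee_two_pi (k : ℤ) : ee k (2 * Real.pi) = 1 := by
  unfold ee
  rw [Complex.exp_eq_one_iff]
  exact ⟨k, by push_cast; ring⟩

lemma ee_periodic (k : ℤ) : Function.Periodic (ee k) (2 * Real.pi) := by
  intro x; rw [ee_addx, ee_two_pi, mul_one]

lemma tp_periodic (s c) : Function.Periodic (tp s c) (2 * Real.pi) := by
  intro x; simp only [tp, ee_periodic _ x]

lemma ee_hasDerivAt (k : ℤ) (x : ℝ) : HasDerivAt (ee k) (Complex.I * k * ee k x) x := by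
  unfold ee
  have h : HasDerivAt (fun y : ℝ => Complex.I * (k : ℂ) * (y : ℂ)) (Complex.I * k * 1) x :=
    (Complex.ofRealCLM.hasDerivAt (x := x)).const_mul _
  convert h.cexp using 1
  ring

lemma tp_hasDerivAt (s c) (x : ℝ) :
    HasDerivAt (tp s c) (tp s (fun k => Complex.I * k * c k) x) x := by
  unfold tp
  have := HasDerivAt.fun_sum (u := s) (fun k _ => (ee_hasDerivAt k x).const_mul (c k))
  refine this.congr_deriv ?_
  exact Finset.sum_congr rfl fun k _ => by ring

lemma int_ee (k : ℤ) : ∫ x in (0 : ℝ)..(2 * Real.pi), ee k x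
    = if k = 0 then 2 * (Real.pi : ℂ) else 0 := by
  split_ifs with h
  · subst h; simp [ee_zero]
  · have h1 : ∀ x ∈ Set.uIcc (0 : ℝ) (2 * Real.pi),
        HasDerivAt (fun y => (Complex.I * k)⁻¹ * ee k y) (ee k x) x := by
      intro x _
      refine ((ee_hasDerivAt k x).const_mul (Complex.I * k)⁻¹).congr_deriv ?_
      have : (Complex.I * k : ℂ) ≠ 0 := by simp [h]
      rw [← mul_assoc, inv_mul_cancel₀ this, one_mul]
    rw [intervalIntegral.integral_eq_sub_of_hasDerivAt h1 ((ee_cont k).intervalIntegrable _ _)]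
    rw [ee_two_pi]; simp [ee]

lemma fc_eq (f : ℝ → ℂ) (k : ℤ) : fc f k =
    (1 / (2 * Real.pi) : ℂ) * ∫ x in (0 : ℝ)..(2 * Real.pi), f x * ee (-k) x := by
  unfold fc
  simp only [ee_neg, Complex.real_smul]
  push_cast; rfl

lemma int_eq_fc (f : ℝ → ℂ) (k : ℤ) :
    ∫ x in (0 : ℝ)..(2 * Real.pi), f x * ee (-k) x = (2 * Real.pi : ℂ) * fc f k := by
  rw [fc_eq]
  have : (Real.pi : ℂ) ≠ 0 := by exact_mod_cast Real.pi_ne_zero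
  field_simp

lemma fc_tp (s : Finset ℤ) (c : ℤ → ℂ) (p : ℤ) : fc (tp s c) p = if p ∈ s then c p else 0 := by
  rw [fc_eq]
  have h1 : ∀ x, tp s c x * ee (-p) x = ∑ k ∈ s, c k * ee (k - p) x := by
    intro x; unfold tp
    rw [Finset.sum_mul]
    exact Finset.sum_congr rfl fun k _ => by rw [sub_eq_add_neg, ee_add, mul_assoc]
  simp only [h1]
  rw [intervalIntegral.integral_finsetSum]
  swap
  · exact fun k _ => (continuous_const.mul (ee_cont _)).intervalIntegrable _ _
  simp only [intervalIntegral.integral_const_mul, int_ee, sub_eq_zero]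
  have : (Real.pi : ℂ) ≠ 0 := by exact_mod_cast Real.pi_ne_zero
  simp only [mul_ite, mul_zero, Finset.sum_ite_eq']
  split_ifs
  · field_simp
  · simp

lemma tp_conj (s c) (x : ℝ) : (starRingEnd ℂ) (tp s c x) =
    ∑ k ∈ s, (starRingEnd ℂ) (c k) * ee (-k) x := by
  simp [tp, ee_conj]

lemma int_conj (s : Finset ℤ) (c : ℤ → ℂ) (F : ℝ → ℂ) (hF : Continuous F) :
    ∫ x in (0 : ℝ)..(2 * Real.pi), (starRingEnd ℂ) (tp s c x) * F x
      = (2 * Real.pi : ℂ) * ∑ k ∈ s, (starRingEnd ℂ) (c k) * fc F k := by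
  have h1 : ∀ x, (starRingEnd ℂ) (tp s c x) * F x
      = ∑ k ∈ s, (starRingEnd ℂ) (c k) * (F x * ee (-k) x) := by
    intro x; rw [tp_conj, Finset.sum_mul]
    exact Finset.sum_congr rfl fun k _ => by ring
  simp only [h1]
  rw [intervalIntegral.integral_finsetSum]
  swap
  · exact fun k _ => (continuous_const.mul (hF.mul (ee_cont _))).intervalIntegrable _ _
  simp only [intervalIntegral.integral_const_mul, int_eq_fc, Finset.mul_sum]
  exact Finset.sum_congr rfl fun k _ => by ring

lemma parseval (s : Finset ℤ) (c : ℤ → ℂ) :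
    ∫ x in (0 : ℝ)..(2 * Real.pi), ‖tp s c x‖ ^ 2 = 2 * Real.pi * ∑ k ∈ s, ‖c k‖ ^ 2 := by
  have h := int_conj s c (tp s c) (tp_cont s c)
  have h2 : ∀ x, (starRingEnd ℂ) (tp s c x) * tp s c x = ((‖tp s c x‖ ^ 2 : ℝ) : ℂ) := by
    intro x; rw [Complex.conj_mul']; push_cast; rfl
  simp only [h2] at h
  rw [intervalIntegral.integral_ofReal] at h
  have h3 : ∑ k ∈ s, (starRingEnd ℂ) (c k) * fc (tp s c) k = ((∑ k ∈ s, ‖c k‖ ^ 2 : ℝ) : ℂ) := by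
    push_cast
    refine Finset.sum_congr rfl fun k hk => ?_
    rw [fc_tp, if_pos hk, Complex.conj_mul']
  rw [h3] at h
  exact_mod_cast h

lemma bessel (F : ℝ → ℂ) (hF : Continuous F) (s : Finset ℤ) :
    2 * Real.pi * ∑ k ∈ s, ‖fc F k‖ ^ 2 ≤ ∫ x in (0 : ℝ)..(2 * Real.pi), ‖F x‖ ^ 2 := by
  set v := tp s (fc F) with hv
  have hvc : Continuous v := tp_cont _ _
  have h0 : 0 ≤ ∫ x in (0 : ℝ)..(2 * Real.pi), ‖F x - v x‖ ^ 2 :=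
    intervalIntegral.integral_nonneg (by positivity) fun x _ => by positivity
  have h1 : ∀ x, ‖F x - v x‖ ^ 2 = ‖F x‖ ^ 2 + ‖v x‖ ^ 2 - 2 * ((starRingEnd ℂ) (v x) * F x).re := by
    intro x
    simp only [← Complex.normSq_eq_norm_sq, Complex.normSq_sub]
    congr 2; rw [mul_comm]
  simp only [h1] at h0
  have hc : Continuous fun x => (starRingEnd ℂ) (v x) * F x :=
    (Complex.continuous_conj.comp hvc).mul hF
  rw [intervalIntegral.integral_sub, intervalIntegral.integral_add,
    intervalIntegral.integral_const_mul, hv, parseval] at h0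
  · have h2 : ∫ x in (0 : ℝ)..(2 * Real.pi), ((starRingEnd ℂ) (v x) * F x).re
        = 2 * Real.pi * ∑ k ∈ s, ‖fc F k‖ ^ 2 := by
      have h3 := Complex.reCLM.intervalIntegral_comp_comm (hc.intervalIntegrable 0 (2 * Real.pi))
        (μ := volume)
      simp only [Complex.reCLM_apply] at h3
      rw [h3, hv, int_conj _ _ _ hF]
      simp only [Complex.conj_mul']
      rw [show (2 * (Real.pi : ℂ) * ∑ k ∈ s, (‖fc F k‖ : ℂ) ^ 2)
        = ((2 * Real.pi * ∑ k ∈ s, ‖fc F k‖ ^ 2 : ℝ) : ℂ) by push_cast; rfl]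
      exact Complex.ofReal_re _
    rw [← hv, h2] at h0
    linarith
  · exact (hF.norm.pow 2).intervalIntegrable _ _
  · exact (hvc.norm.pow 2).intervalIntegrable _ _
  · exact ((hF.norm.pow 2).add (hvc.norm.pow 2)).intervalIntegrable _ _
  · exact (continuous_const.mul (Complex.continuous_re.comp hc)).intervalIntegrable _ _

lemma fc_deriv (f : ℝ → ℂ) (hf : ContDiff ℝ 1 f) (hp : Function.Periodic f (2 * Real.pi)) (k : ℤ) :
    fc (deriv f) k = Complex.I * k * fc f k := by
  have hd : Continuous (deriv f) := hf.continuous_deriv le_rfl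
  have h := intervalIntegral.integral_mul_deriv_eq_deriv_mul (a := 0) (b := 2 * Real.pi)
    (u := ee (-k)) (v := f) (u' := fun x => Complex.I * ((-k : ℤ) : ℂ) * ee (-k) x) (v' := deriv f)
    (fun x _ => ee_hasDerivAt _ x)
    (fun x _ => (hf.differentiable (by norm_num) x).hasDerivAt)
    ((continuous_const.mul (ee_cont _)).intervalIntegrable _ _) (hd.intervalIntegrable _ _)
  have e0 : f (2 * Real.pi) = f 0 := by simpa using hp 0
  rw [e0, ee_two_pi, show ee (-k) 0 = 1 by simp [ee], sub_self, zero_sub] at h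
  rw [fc_eq, fc_eq]
  simp only [mul_comm (deriv f _), h]
  simp only [mul_assoc, intervalIntegral.integral_const_mul, mul_comm (f _)]
  push_cast; ring

lemma fc_summable (f : ℝ → ℂ) (hf : ContDiff ℝ 1 f) (hp : Function.Periodic f (2 * Real.pi)) :
    Summable (fc f) := by
  have hd : Continuous (deriv f) := hf.continuous_deriv le_rfl
  have s1 : Summable fun k => ‖fc (deriv f) k‖ ^ 2 := by
    refine summable_of_sum_le (fun k => by positivity)
      (c := (∫ x in (0 : ℝ)..(2 * Real.pi), ‖deriv f x‖ ^ 2) / (2 * Real.pi)) fun s => ?_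
    rw [le_div_iff₀ (by positivity), mul_comm]
    exact bessel _ hd s
  have s2 : Summable fun k : ℤ => 1 / (k : ℝ) ^ 2 :=
    (Real.summable_one_div_int_pow (p := 2)).2 (by norm_num)
  refine Summable.of_norm_bounded_eventually (s1.add s2) ?_
  have : ({0} : Set ℤ)ᶜ ∈ cofinite := (Set.finite_singleton 0).compl_mem_cofinite
  filter_upwards [this] with k hk
  have hk : (k : ℝ) ≠ 0 := by exact_mod_cast hk
  rw [fc_deriv f hf hp, norm_mul, norm_mul]
  simp only [Complex.norm_I, one_mul, Complex.norm_intCast]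
  have hk' : 0 < |(k : ℝ)| := abs_pos.2 hk
  have : ‖fc f k‖ = (|(k:ℝ)| * ‖fc f k‖) * (1 / |(k:ℝ)|) := by field_simp
  rw [this, ← sq_abs (k : ℝ), show 1 / |(k:ℝ)| ^ 2 = (1 / |(k:ℝ)|) ^ 2 by rw [one_div_pow]]
  rw [← this]
  nlinarith [sq_nonneg (|(k:ℝ)| * ‖fc f k‖ - 1 / |(k:ℝ)|), sq_nonneg (|(k:ℝ)| * ‖fc f k‖),
    sq_nonneg (1 / |(k:ℝ)|)]

lemma fc_hasSum (f : ℝ → ℂ) (hf : ContDiff ℝ 1 f) (hp : Function.Periodic f (2 * Real.pi)) (x : ℝ) :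
    HasSum (fun k => fc f k * ee k x) (f x) := by
  have : Fact (0 < 2 * Real.pi) := ⟨by positivity⟩
  let g : C(AddCircle (2 * Real.pi), ℂ) := ⟨hp.lift, by
    apply continuous_coinduced_dom.mpr
    exact hf.continuous⟩
  have hee : ∀ (k : ℤ) (y : ℝ), fourier k (y : AddCircle (2 * Real.pi)) = ee k y := by
    intro k y
    rw [fourier_coe_apply]; unfold ee; congr 1
    have : (Real.pi : ℂ) ≠ 0 := by exact_mod_cast Real.pi_ne_zero
    push_cast; field_simp
  have hc : fourierCoeff g = fc f := by
    funext k
    rw [fourierCoeff_eq_intervalIntegral _ _ 0, fc_eq, zero_add, Complex.real_smul]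
    push_cast
    congr 1
    refine intervalIntegral.integral_congr fun y _ => ?_
    simp only [hee, smul_eq_mul]
    rw [mul_comm]; rfl
  have h := has_pointwise_sum_fourier_series_of_summable (f := g)
    (by rw [hc]; exact fc_summable f hf hp) (x : AddCircle (2 * Real.pi))
  simp only [hc, hee, smul_eq_mul] at h
  exact h

lemma itp_iff {N : ℕ} {f : ℝ → ℂ} :
    IsTrigPoly N f ↔ ∃ c, f = tp (Finset.Icc (-(N : ℤ)) (N : ℤ)) c := by
  constructor
  · rintro ⟨c, hc⟩; exact ⟨c, funext hc⟩
  · rintro ⟨c, rfl⟩; exact ⟨c, fun x => rfl⟩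

lemma itp_zero (N : ℕ) : IsTrigPoly N (fun _ => 0) := ⟨fun _ => 0, by simp⟩

lemma itp_add {N : ℕ} {f g : ℝ → ℂ} (hf : IsTrigPoly N f) (hg : IsTrigPoly N g) :
    IsTrigPoly N (fun x => f x + g x) := by
  obtain ⟨c, hc⟩ := hf
  obtain ⟨d, hd⟩ := hg
  refine ⟨fun k => c k + d k, fun x => ?_⟩
  simp only [hc, hd, ← Finset.sum_add_distrib, add_mul]

lemma itp_cmul {N : ℕ} {f : ℝ → ℂ} (a : ℂ) (hf : IsTrigPoly N f) :
    IsTrigPoly N (fun x => a * f x) := by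
  obtain ⟨c, hc⟩ := hf
  refine ⟨fun k => a * c k, fun x => ?_⟩
  simp only [hc, Finset.mul_sum, mul_assoc]

lemma itp_sum {N : ℕ} {ι : Type*} (s : Finset ι) (f : ι → ℝ → ℂ)
    (hf : ∀ i ∈ s, IsTrigPoly N (f i)) : IsTrigPoly N (fun x => ∑ i ∈ s, f i x) := by
  classical
  induction s using Finset.induction_on with
  | empty => simpa using itp_zero N
  | insert a s ha ih =>
    simp only [Finset.sum_insert ha]
    exact itp_add (hf a (by simp)) (ih fun i hi => hf i (by simp [hi]))

lemma itp_ee {N : ℕ} {k : ℤ} (hk : |k| ≤ N) : IsTrigPoly N (ee k) := by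
  refine ⟨fun j => if j = k then 1 else 0, fun x => ?_⟩
  rw [abs_le] at hk
  simp only [ite_mul, one_mul, zero_mul, Finset.sum_ite_eq', Finset.mem_Icc, hk, and_self, if_true]
  rfl

lemma itp_tp {N : ℕ} {s : Finset ℤ} {c : ℤ → ℂ} (hs : ∀ k ∈ s, |k| ≤ (N : ℤ)) :
    IsTrigPoly N (tp s c) :=
  itp_sum s _ fun k hk => itp_cmul _ (itp_ee (hs k hk))

lemma itp_mul {N M : ℕ} {f g : ℝ → ℂ} (hf : IsTrigPoly N f) (hg : IsTrigPoly M g) :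
    IsTrigPoly (N + M) (fun x => f x * g x) := by
  obtain ⟨c, rfl⟩ := itp_iff.1 hf
  obtain ⟨d, rfl⟩ := itp_iff.1 hg
  have : (fun x => tp (Finset.Icc (-(N : ℤ)) (N : ℤ)) c x * tp (Finset.Icc (-(M : ℤ)) (M : ℤ)) d x)
    = fun x => ∑ j ∈ Finset.Icc (-(N : ℤ)) (N : ℤ), ∑ k ∈ Finset.Icc (-(M : ℤ)) (M : ℤ),
      (c j * d k) * ee (j + k) x := by
    funext x
    simp only [tp, Finset.sum_mul_sum, ee_add]
    exact Finset.sum_congr rfl fun j _ => Finset.sum_congr rfl fun k _ => by ring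
  rw [this]
  refine itp_sum _ _ fun j hj => itp_sum _ _ fun k hk => itp_cmul _ (itp_ee ?_)
  rw [Finset.mem_Icc] at hj hk
  rw [abs_le]; push_cast; omega

lemma itp_conj {N : ℕ} {f : ℝ → ℂ} (hf : IsTrigPoly N f) :
    IsTrigPoly N (fun x => (starRingEnd ℂ) (f x)) := by
  obtain ⟨c, rfl⟩ := itp_iff.1 hf
  simp only [tp_conj]
  refine itp_sum _ _ fun k hk => itp_cmul _ (itp_ee ?_)
  rw [Finset.mem_Icc] at hk
  rw [abs_le]; omega

lemma per_int (f : ℝ → ℝ) (hf : Function.Periodic f (2 * Real.pi)) :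
    ∫ x in (-Real.pi)..Real.pi, f x = ∫ x in (0 : ℝ)..(2 * Real.pi), f x := by
  have := hf.intervalIntegral_add_eq (-Real.pi) 0
  rw [zero_add] at this
  rw [← this]; congr 1; ring

/-- The integers `0, …, K - 1`. -/
def zr (K : ℕ) : Finset ℤ := (Finset.range K).map Nat.castEmbedding

lemma sum_zr {A : Type*} [AddCommMonoid A] (K : ℕ) (f : ℤ → A) :
    ∑ k ∈ zr K, f k = ∑ k ∈ Finset.range K, f (k : ℤ) := by
  simp [zr]

lemma sumA (K J : ℕ) : ∑ k ∈ Finset.range J, (((k : ℝ) + 1) * (K + 1 - k)) ^ 2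
    = ((K : ℝ) + 2) ^ 2 * (J * (J + 1) * (2 * J + 1)) / 6 - (K + 2) * (J * (J + 1)) ^ 2 / 2
      + J * (J + 1) * (2 * J + 1) * (3 * J ^ 2 + 3 * J - 1) / 30 := by
  induction J with
  | zero => simp
  | succ J ih => rw [Finset.sum_range_succ, ih]; push_cast; ring

lemma sumB (K J : ℕ) : ∑ k ∈ Finset.range J, ((K : ℝ) + 1 - 2 * k) ^ 2
    = J * ((K : ℝ) + 1) ^ 2 - 2 * (K + 1) * (J * (J - 1)) + 2 * (J - 1) * J * (2 * J - 1) / 3 := by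
  induction J with
  | zero => simp
  | succ J ih => rw [Finset.sum_range_succ, ih]; push_cast; ring

lemma exists_kernel (K : ℕ) : ∃ J : ℝ → ℝ, Continuous J ∧ (∀ t, 0 ≤ J t) ∧
    (∫ t in (-Real.pi)..Real.pi, J t) = 1 ∧
    (∫ t in (-Real.pi)..Real.pi, J t * |t|) ≤ 13 / ((K : ℝ) + 1) ∧
    IsTrigPoly (2 * K) (fun t => (J t : ℂ)) := by
  set a : ℤ → ℂ := fun k => (((k : ℝ) + 1) * (K + 1 - k) : ℝ) with ha
  set b : ℤ → ℂ := fun k => ((K : ℝ) + 1 - 2 * k : ℝ) with hb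
  set E := tp (zr (K + 1)) a with hE
  set B := tp (zr (K + 2)) b with hB
  have hEc : Continuous E := tp_cont _ _
  have hBc : Continuous B := tp_cont _ _
  set n : ℝ := (K : ℝ) + 2 with hn
  have hn2 : 2 ≤ n := by rw [hn]; linarith [Nat.cast_nonneg (α := ℝ) K]
  have hEB : ∀ t, B t = E t * (1 - ee 1 t) := by
    intro t
    simp only [hE, hB, tp, sum_zr]
    have e1 : ∑ k ∈ Finset.range (K + 2), a (k : ℤ) * ee (k : ℤ) t
        = ∑ k ∈ Finset.range (K + 1), a (k : ℤ) * ee (k : ℤ) t := by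
      rw [Finset.sum_range_succ]; simp [ha]
    have e2 : ∑ k ∈ Finset.range (K + 2), a ((k : ℤ) - 1) * ee (k : ℤ) t
        = ∑ k ∈ Finset.range (K + 1), a (k : ℤ) * (ee (k : ℤ) t * ee 1 t) := by
      rw [Finset.sum_range_succ']; simp [ha, ee_add]
    rw [mul_sub, mul_one, Finset.sum_mul]
    simp only [mul_assoc]
    rw [← e1, ← e2, ← Finset.sum_sub_distrib]
    refine Finset.sum_congr rfl fun k _ => ?_
    rw [← sub_mul]; congr 1
    simp only [ha, hb]; push_cast; ring
  set Sa : ℝ := n * (n ^ 4 - 1) / 30 with hSa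
  have n4 : 1 < n ^ 4 := one_lt_pow₀ (by linarith) (by norm_num)
  have hSa0 : 0 < Sa := by rw [hSa]; apply div_pos (mul_pos (by linarith) (by linarith)); norm_num
  set Sb : ℝ := n * (n ^ 2 - 1) / 3 with hSb
  have hSb0 : 0 ≤ Sb := by
    rw [hSb]; apply div_nonneg (mul_nonneg (by linarith) (by nlinarith)); norm_num
  have hpi := Real.pi_pos
  have iE : ∫ t in (-Real.pi)..Real.pi, ‖E t‖ ^ 2 = 2 * Real.pi * Sa := by
    rw [per_int _ (fun x => by rw [hE, tp_periodic]), hE, parseval, sum_zr]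
    congr 1
    rw [hSa, hn]
    simp only [ha, Complex.norm_real, Real.norm_eq_abs, sq_abs, Int.cast_natCast]
    rw [sumA]; push_cast; ring
  have iB : ∫ t in (-Real.pi)..Real.pi, ‖B t‖ ^ 2 = 2 * Real.pi * Sb := by
    rw [per_int _ (fun x => by rw [hB, tp_periodic]), hB, parseval, sum_zr]
    congr 1
    rw [hSb, hn]
    simp only [hb, Complex.norm_real, Real.norm_eq_abs, sq_abs, Int.cast_natCast]
    rw [sumB]; push_cast; ring
  have hBn : ∀ t, ‖B t‖ ^ 2 = ‖E t‖ ^ 2 * (2 - 2 * Real.cos t) := by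
    intro t
    rw [hEB, norm_mul, mul_pow]; congr 1
    rw [← Complex.normSq_eq_norm_sq]
    have : ee 1 t = ⟨Real.cos t, Real.sin t⟩ := by
      unfold ee
      rw [show Complex.I * ((1 : ℤ) : ℂ) * (t : ℂ) = t * Complex.I by push_cast; ring]
      apply Complex.ext
      · exact Complex.exp_ofReal_mul_I_re t
      · exact Complex.exp_ofReal_mul_I_im t
    rw [this, Complex.normSq_apply]
    simp only [Complex.sub_re, Complex.sub_im, Complex.one_re, Complex.one_im]
    nlinarith [Real.sin_sq_add_cos_sq t]
  have hSS : Sb ≤ 10 / n ^ 2 * Sa := by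
    rw [hSb, hSa, div_mul_eq_mul_div, le_div_iff₀ (by positivity)]
    nlinarith [mul_nonneg (by linarith : (0:ℝ) ≤ n) (by nlinarith : (0:ℝ) ≤ n ^ 2 - 1)]
  refine ⟨fun t => (2 * Real.pi * Sa)⁻¹ * ‖E t‖ ^ 2, by fun_prop, fun t => by positivity, ?_, ?_, ?_⟩
  · rw [intervalIntegral.integral_const_mul, iE, inv_mul_cancel₀ (by positivity)]
  · have h1 : (∫ t in (-Real.pi)..Real.pi, ‖E t‖ ^ 2 * |t|) ≤
        ∫ t in (-Real.pi)..Real.pi, (n * Real.pi ^ 2 / 8 * ‖B t‖ ^ 2 + 1 / (2 * n) * ‖E t‖ ^ 2) := by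
      apply intervalIntegral.integral_mono_on (by linarith)
      · exact Continuous.intervalIntegrable (by fun_prop) _ _
      · exact Continuous.intervalIntegrable (by fun_prop) _ _
      · intro t ht
        have hc := Real.cos_le_one_sub_mul_cos_sq (abs_le.2 ht)
        have ht2 : t ^ 2 ≤ Real.pi ^ 2 / 2 * (1 - Real.cos t) := by
          have : t ^ 2 = Real.pi ^ 2 / 2 * (2 / Real.pi ^ 2 * t ^ 2) := by field_simp
          rw [this]
          apply mul_le_mul_of_nonneg_left _ (by positivity)
          linarith
        have h2 : |t| ≤ n / 2 * t ^ 2 + 1 / (2 * n) := by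
          have : n / 2 * t ^ 2 + 1 / (2 * n) - |t| = (n * |t| - 1) ^ 2 / (2 * n) := by
            rw [← sq_abs t]; field_simp; ring
          have h3 : 0 ≤ (n * |t| - 1) ^ 2 / (2 * n) := by positivity
          linarith
        have h3 : |t| ≤ n * Real.pi ^ 2 / 8 * (2 - 2 * Real.cos t) + 1 / (2 * n) := by
          have := mul_le_mul_of_nonneg_left ht2 (by linarith : 0 ≤ n / 2)
          linarith
        rw [hBn]
        have := mul_le_mul_of_nonneg_left h3 (by positivity : 0 ≤ ‖E t‖ ^ 2)
        linarith
    rw [intervalIntegral.integral_add (Continuous.intervalIntegrable (by fun_prop) _ _)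
      (Continuous.intervalIntegrable (by fun_prop) _ _), intervalIntegral.integral_const_mul,
      intervalIntegral.integral_const_mul, iE, iB] at h1
    simp only [mul_assoc ((2 * Real.pi * Sa)⁻¹), intervalIntegral.integral_const_mul]
    rw [inv_mul_le_iff₀ (by positivity)]
    have hp2 : Real.pi ^ 2 ≤ 10 := by nlinarith [Real.pi_lt_d2, Real.pi_gt_three]
    have h4 : n * Real.pi ^ 2 / 8 * Sb + 1 / (2 * n) * Sa ≤ 13 / n * Sa := by
      have : n * Real.pi ^ 2 / 8 * Sb ≤ n * 10 / 8 * (10 / n ^ 2 * Sa) := by gcongr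
      have e : n * 10 / 8 * (10 / n ^ 2 * Sa) + 1 / (2 * n) * Sa = 13 / n * Sa := by
        field_simp; norm_num
      linarith
    have h5 : 13 / n * Sa ≤ Sa * (13 / ((K : ℝ) + 1)) := by
      rw [mul_comm]; gcongr; rw [hn]; linarith
    have := mul_le_mul_of_nonneg_left (h4.trans h5) (by positivity : 0 ≤ 2 * Real.pi)
    linarith
  · have hEt : IsTrigPoly K E := itp_tp (fun k hk => by
      simp only [zr, Finset.mem_map, Finset.mem_range] at hk
      obtain ⟨i, hi, rfl⟩ := hk
      simp only [Nat.castEmbedding_apply, Nat.abs_cast]; omega)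
    have := itp_cmul ((2 * Real.pi * Sa)⁻¹ : ℝ) (itp_mul (itp_conj hEt) hEt)
    rw [← two_mul] at this
    convert this using 2 with t
    rw [Complex.conj_mul']; push_cast; rfl

/-- `f` minus its average against the kernel `J`. -/
noncomputable def UU (J : ℝ → ℝ) (f : ℝ → ℝ) (x : ℝ) : ℝ :=
  f x - ∫ t in (-Real.pi)..Real.pi, J t * f (x - t)

lemma UU_cont {J f : ℝ → ℝ} (hJ : Continuous J) (hf : Continuous f) : Continuous (UU J f) := by
  unfold UU
  refine hf.sub ?_
  apply intervalIntegral.continuous_parametric_intervalIntegral_of_continuous'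
  fun_prop

lemma UU_diff {J f : ℝ → ℝ} (hJ : Continuous J) (hf : Continuous f) (h : ℝ) :
    UU J (fun x => f x - f (x - h)) = fun x => UU J f x - UU J f (x - h) := by
  funext x
  unfold UU
  have : ∀ t, J t * (f (x - t) - f (x - t - h)) = J t * f (x - t) - J t * f (x - h - t) := by
    intro t; rw [show x - t - h = x - h - t by ring]; ring
  simp only [this]
  rw [intervalIntegral.integral_sub (Continuous.intervalIntegrable (by fun_prop) _ _)
    (Continuous.intervalIntegrable (by fun_prop) _ _)]
  ring

lemma UUs_cont {J f : ℝ → ℝ} (hJ : Continuous J) (hf : Continuous f) (s : ℕ) :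
    Continuous ((UU J)^[s] f) := by
  induction s with
  | zero => exact hf
  | succ s ih => rw [Function.iterate_succ_apply']; exact UU_cont hJ ih

lemma UUs_diff {J f : ℝ → ℝ} (hJ : Continuous J) (hf : Continuous f) (h : ℝ) (s : ℕ) :
    (UU J)^[s] (fun x => f x - f (x - h)) = fun x => (UU J)^[s] f x - (UU J)^[s] f (x - h) := by
  induction s with
  | zero => rfl
  | succ s ih =>
    simp only [Function.iterate_succ_apply']
    rw [ih, UU_diff hJ (UUs_cont hJ hf s)]

lemma UUs_bound {J : ℝ → ℝ} (hJ : Continuous J) (hJ0 : ∀ t, 0 ≤ J t)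
    (hJ1 : (∫ t in (-Real.pi)..Real.pi, J t) = 1) {c : ℝ}
    (hJc : (∫ t in (-Real.pi)..Real.pi, J t * |t|) ≤ c) (s : ℕ) :
    ∀ (f : ℝ → ℝ), ContDiff ℝ s f → ∀ M, (∀ x, |iteratedDeriv s f x| ≤ M) →
      ∀ x, |(UU J)^[s] f x| ≤ c ^ s * M := by
  have hpi := Real.pi_pos
  have hc0 : 0 ≤ c := le_trans (intervalIntegral.integral_nonneg (by linarith)
    fun t _ => mul_nonneg (hJ0 t) (abs_nonneg t)) hJc
  induction s with
  | zero => intro f _ M hM x; simpa using hM x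
  | succ s ih =>
    intro f hf M hM x
    have hM0 : 0 ≤ M := (abs_nonneg _).trans (hM 0)
    have hfs : ContDiff ℝ s f := hf.of_le (by exact_mod_cast Nat.le_succ s)
    set F := (UU J)^[s] f with hF
    have hFc : Continuous F := UUs_cont hJ hf.continuous s
    have hlip : ∀ h, |F x - F (x - h)| ≤ c ^ s * (M * |h|) := by
      intro h
      have e := congrFun (UUs_diff hJ hf.continuous h s) x
      rw [hF, ← e]
      have hsh : ContDiff ℝ s (fun y => f (y - h)) := hfs.comp (contDiff_id.sub contDiff_const)
      refine ih _ (hfs.sub hsh) _ (fun y => ?_) x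
      rw [iteratedDeriv_fun_sub hfs.contDiffAt hsh.contDiffAt, iteratedDeriv_comp_sub_const]
      have hd : Differentiable ℝ (iteratedDeriv s f) :=
        hf.differentiable_iteratedDeriv s (by exact_mod_cast Nat.lt_succ_self s)
      have := Convex.norm_image_sub_le_of_norm_deriv_le (f := iteratedDeriv s f) (s := Set.univ)
        (C := M) (x := y - h) (y := y) (fun z _ => hd z)
        (fun z _ => by rw [← iteratedDeriv_succ]; exact hM z) convex_univ trivial trivial
      simpa using this
    rw [Function.iterate_succ_apply', ← hF]
    have e1 : UU J F x = ∫ t in (-Real.pi)..Real.pi, J t * (F x - F (x - t)) := by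
      simp only [mul_sub]
      rw [intervalIntegral.integral_sub (Continuous.intervalIntegrable (by fun_prop) _ _)
        (Continuous.intervalIntegrable (by fun_prop) _ _), intervalIntegral.integral_mul_const, hJ1,
        one_mul]
      rfl
    rw [e1]
    calc |∫ t in (-Real.pi)..Real.pi, J t * (F x - F (x - t))|
        ≤ ∫ t in (-Real.pi)..Real.pi, |J t * (F x - F (x - t))| :=
          intervalIntegral.abs_integral_le_integral_abs (by linarith)
      _ ≤ ∫ t in (-Real.pi)..Real.pi, (c ^ s * M) * (J t * |t|) := by
          apply intervalIntegral.integral_mono_on (by linarith)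
          · exact Continuous.intervalIntegrable (by fun_prop) _ _
          · exact Continuous.intervalIntegrable (by fun_prop) _ _
          · intro t _
            rw [abs_mul, abs_of_nonneg (hJ0 t)]
            have := mul_le_mul_of_nonneg_left (hlip t) (hJ0 t)
            linarith
      _ ≤ c ^ (s + 1) * M := by
          rw [intervalIntegral.integral_const_mul, pow_succ]
          have := mul_le_mul_of_nonneg_left hJc (by positivity : 0 ≤ c ^ s * M)
          linarith

lemma itp_per {N : ℕ} {f : ℝ → ℂ} (hf : IsTrigPoly N f) : Function.Periodic f (2 * Real.pi) := by
  obtain ⟨c, rfl⟩ := itp_iff.1 hf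
  exact tp_periodic _ _

lemma itp_contDiff {N : ℕ} {f : ℝ → ℂ} (hf : IsTrigPoly N f) (n : WithTop ℕ∞) :
    ContDiff ℝ n f := by
  obtain ⟨c, rfl⟩ := itp_iff.1 hf
  exact tp_contDiff _ _ _

lemma conv_itp {J f : ℝ → ℝ} {D : ℕ} (hJt : IsTrigPoly D (fun t => (J t : ℂ)))
    (hf : Continuous f) (hp : Function.Periodic f (2 * Real.pi)) :
    IsTrigPoly D (fun x => ((∫ t in (-Real.pi)..Real.pi, J t * f (x - t) : ℝ) : ℂ)) := by
  have hJp : Function.Periodic J (2 * Real.pi) := fun t => by exact_mod_cast itp_per hJt t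
  obtain ⟨d, hd⟩ := itp_iff.1 hJt
  have e : ∀ x, ((∫ t in (-Real.pi)..Real.pi, J t * f (x - t) : ℝ) : ℂ) =
      ∑ p ∈ Finset.Icc (-(D : ℤ)) (D : ℤ), (d p * (2 * Real.pi * fc (fun t => (f t : ℂ)) p)) * ee p x := by
    intro x
    have e1 : (∫ t in (-Real.pi)..Real.pi, J t * f (x - t))
        = ∫ u in (0 : ℝ)..(2 * Real.pi), J (x - u) * f u := by
      have := intervalIntegral.integral_comp_sub_left (a := -Real.pi) (b := Real.pi)
        (fun u => J (x - u) * f u) x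
      simp only [sub_sub_cancel] at this
      rw [this]
      have hper : Function.Periodic (fun u => J (x - u) * f u) (2 * Real.pi) := by
        intro u
        simp only [hp u]
        rw [← hJp (x - (u + 2 * Real.pi))]
        congr 2; ring
      have h2 := hper.intervalIntegral_add_eq (x - Real.pi) 0
      rw [zero_add] at h2
      rw [← h2]; congr 1; ring
    rw [e1, ← intervalIntegral.integral_ofReal]
    have e2 : ∀ u, ((J (x - u) * f u : ℝ) : ℂ) = ∑ p ∈ Finset.Icc (-(D : ℤ)) (D : ℤ),
        (d p * ee p x) * ((f u : ℂ) * ee (-p) u) := by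
      intro u
      have := congrFun hd (x - u)
      push_cast
      rw [this, tp, Finset.sum_mul]
      refine Finset.sum_congr rfl fun p _ => ?_
      rw [sub_eq_add_neg, ee_addx, show ee p (-u) = ee (-p) u by unfold ee; push_cast; ring_nf]
      ring
    simp only [e2]
    rw [intervalIntegral.integral_finsetSum]
    swap
    · exact fun k _ => (continuous_const.mul
        ((Complex.continuous_ofReal.comp hf).mul (ee_cont _))).intervalIntegrable _ _
    refine Finset.sum_congr rfl fun p _ => ?_
    rw [intervalIntegral.integral_const_mul, int_eq_fc]
    ring
  simp only [e]
  exact ⟨fun p => d p * (2 * Real.pi * fc (fun t => (f t : ℂ)) p), fun x => rfl⟩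

lemma UUs_itp {J f : ℝ → ℝ} {D : ℕ} (hJt : IsTrigPoly D (fun t => (J t : ℂ))) (hJ : Continuous J)
    (hf : Continuous f) (hp : Function.Periodic f (2 * Real.pi)) (s : ℕ) :
    IsTrigPoly D (fun x => (f x : ℂ) - ((UU J)^[s] f x : ℝ)) := by
  induction s with
  | zero => simpa using itp_zero D
  | succ s ih =>
    have hFc : Continuous ((UU J)^[s] f) := UUs_cont hJ hf s
    have hFp : Function.Periodic ((UU J)^[s] f) (2 * Real.pi) := by
      intro x
      have := itp_per ih x
      simp only [hp x] at this
      have := sub_right_inj.1 this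
      exact_mod_cast this
    have := itp_add ih (conv_itp hJt hFc hFp)
    convert this using 2 with x
    rw [Function.iterate_succ_apply']
    unfold UU
    push_cast; ring

/-- Jackson theorem. -/
lemma jackson (r N : ℕ) (hN : 1 ≤ N) (q : ℝ → ℝ) (hq : ContDiff ℝ r q)
    (hp : Function.Periodic q (2 * Real.pi)) (M : ℝ) (hM : ∀ x, |iteratedDeriv r q x| ≤ M) :
    ∃ g : ℝ → ℝ, (∀ x, |g x| ≤ (39 / (N : ℝ)) ^ r * M) ∧
      IsTrigPoly (2 * (N / 3)) (fun x => (q x : ℂ) - (g x : ℝ)) := by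
  obtain ⟨J, hJ, hJ0, hJ1, hJc, hJt⟩ := exists_kernel (N / 3)
  refine ⟨(UU J)^[r] q, ?_, UUs_itp hJt hJ hq.continuous hp r⟩
  refine UUs_bound hJ hJ0 hJ1 (hJc.trans ?_) r q hq M hM
  have hN' : (0 : ℝ) < N := by exact_mod_cast hN
  have : (N : ℝ) ≤ 3 * (((N / 3 : ℕ) : ℝ) + 1) := by
    have : N ≤ 3 * (N / 3 + 1) := by omega
    exact_mod_cast this
  rw [div_le_div_iff₀ (by positivity) hN']
  linarith

/-- Sampling points. -/
noncomputable def xs (L n : ℕ) : ℝ := n * (2 * Real.pi / L)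

lemma ortho (L : ℕ) (hL : 1 ≤ L) (p : ℤ) :
    ∑ n ∈ Finset.range L, ee p (xs L n) = if (L : ℤ) ∣ p then (L : ℂ) else 0 := by
  have hL0 : (L : ℂ) ≠ 0 := by exact_mod_cast (by omega : L ≠ 0)
  have hpi : (Real.pi : ℂ) ≠ 0 := by exact_mod_cast Real.pi_ne_zero
  set z := ee p (2 * Real.pi / L) with hz
  have e : ∀ n : ℕ, ee p (xs L n) = z ^ n := by
    intro n
    rw [hz, xs]; unfold ee
    rw [← Complex.exp_nat_mul]; congr 1; push_cast; ring
  simp only [e]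
  have hzL : z ^ L = 1 := by
    rw [← e, xs, show (L : ℝ) * (2 * Real.pi / L) = 2 * Real.pi by
      have : (L : ℝ) ≠ 0 := by exact_mod_cast (by omega : L ≠ 0)
      field_simp, ee_two_pi]
  split_ifs with h
  · obtain ⟨j, rfl⟩ := h
    have : z = 1 := by
      rw [hz]; unfold ee
      rw [Complex.exp_eq_one_iff]
      refine ⟨j, ?_⟩
      push_cast; field_simp
    simp [this]
  · have hz1 : z ≠ 1 := by
      intro h1
      rw [hz] at h1; unfold ee at h1
      rw [Complex.exp_eq_one_iff] at h1
      obtain ⟨j, hj⟩ := h1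
      apply h
      refine ⟨j, ?_⟩
      have hI := Complex.I_ne_zero
      push_cast at hj
      field_simp at hj
      have : (p : ℂ) = ((L * j : ℤ) : ℂ) := by push_cast; linear_combination hj
      exact_mod_cast this
    rw [geom_sum_eq hz1, hzL]; simp

lemma sampling (f : ℝ → ℂ) (hf : ContDiff ℝ 1 f) (hp : Function.Periodic f (2 * Real.pi))
    (L : ℕ) (hL : 1 ≤ L) (k : ℤ) :
    HasSum (fun l : ℤ => fc f (k + l * L))
      ((1 / (L : ℂ)) * ∑ n ∈ Finset.range L, f (xs L n) * ee (-k) (xs L n)) := by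
  have hL0 : (L : ℂ) ≠ 0 := by exact_mod_cast (by omega : L ≠ 0)
  have h1 := (hasSum_sum (s := Finset.range L) fun n _ =>
    (fc_hasSum f hf hp (xs L n)).mul_right (ee (-k) (xs L n))).mul_left (1 / (L : ℂ))
  have h2 : ∀ p, (1 / (L : ℂ)) * ∑ n ∈ Finset.range L, fc f p * ee p (xs L n) * ee (-k) (xs L n)
      = if (L : ℤ) ∣ p - k then fc f p else 0 := by
    intro p
    have : ∀ n, fc f p * ee p (xs L n) * ee (-k) (xs L n) = fc f p * ee (p - k) (xs L n) := by
      intro n; rw [sub_eq_add_neg, ee_add]; ring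
    simp only [this]
    rw [← Finset.mul_sum, ortho L hL]
    split_ifs
    · field_simp
    · simp
  simp only [h2] at h1
  have hinj : Function.Injective (fun l : ℤ => k + l * L) := by
    intro a b hab
    have : a * (L : ℤ) = b * L := by simpa using hab
    exact mul_right_cancel₀ (by exact_mod_cast (by omega : L ≠ 0)) this
  have h3 := (hinj.hasSum_iff (f := fun p => if (L : ℤ) ∣ p - k then fc f p else 0) ?_).2 h1
  · convert h3 using 2 with l
    simp
  · intro p hp'
    rw [if_neg]
    rintro ⟨j, hj⟩
    exact hp' ⟨j, by simp only; linarith⟩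

lemma disc_parseval (L m : ℕ) (hm : 2 * m < L) (c : ℤ → ℂ) :
    ∑ n ∈ Finset.range L, ‖tp (Finset.Icc (-(m : ℤ)) (m : ℤ)) c (xs L n)‖ ^ 2
      = L * ∑ k ∈ Finset.Icc (-(m : ℤ)) (m : ℤ), ‖c k‖ ^ 2 := by
  set s := Finset.Icc (-(m : ℤ)) (m : ℤ) with hs
  have h : ∀ x, ((‖tp s c x‖ ^ 2 : ℝ) : ℂ)
      = ∑ j ∈ s, ∑ k ∈ s, ((starRingEnd ℂ) (c j) * c k) * ee (k - j) x := by
    intro x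
    push_cast
    rw [← Complex.conj_mul', tp_conj, tp, Finset.sum_mul_sum]
    refine Finset.sum_congr rfl fun j _ => Finset.sum_congr rfl fun k _ => ?_
    rw [sub_eq_add_neg, ee_add]; ring
  apply Complex.ofReal_injective
  rw [Complex.ofReal_sum]
  simp only [h]
  rw [Finset.sum_comm]
  push_cast
  rw [Finset.mul_sum]
  refine Finset.sum_congr rfl fun j hj => ?_
  rw [Finset.sum_comm]
  simp only [← Finset.mul_sum, ortho L (by omega)]
  rw [Finset.sum_eq_single j]
  · simp only [sub_self, dvd_zero, if_true]
    rw [Complex.conj_mul']; ring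
  · intro k hk hkj
    rw [if_neg, mul_zero]
    intro hd
    rw [hs, Finset.mem_Icc] at hj hk
    have := Int.eq_zero_of_abs_lt_dvd hd (by rw [abs_lt]; omega)
    omega
  · intro h; exact absurd hj h

lemma fc_itp {D : ℕ} {f : ℝ → ℂ} (hf : IsTrigPoly D f) {p : ℤ} (hp : (D : ℤ) < |p|) : fc f p = 0 := by
  obtain ⟨c, rfl⟩ := itp_iff.1 hf
  rw [fc_tp, if_neg]
  rw [Finset.mem_Icc, ← abs_le]; omega

lemma fc_add {f g : ℝ → ℂ} (hf : Continuous f) (hg : Continuous g) (p : ℤ) :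
    fc (fun x => f x + g x) p = fc f p + fc g p := by
  simp only [fc_eq, add_mul]
  rw [intervalIntegral.integral_add, mul_add]
  · exact (hf.mul (ee_cont _)).intervalIntegrable _ _
  · exact (hg.mul (ee_cont _)).intervalIntegrable _ _

lemma amgm {a b N : ℝ} (hN : 0 < N) : a * b ≤ (N * a ^ 2 + b ^ 2 / N) / 2 := by
  have : (N * a ^ 2 + b ^ 2 / N) / 2 - a * b = (N * a - b) ^ 2 / (2 * N) := by
    field_simp; ring
  have h : 0 ≤ (N * a - b) ^ 2 / (2 * N) := by positivity
  linarith

lemma core (N m : ℕ) (hN : 1 ≤ N) (hm : 3 * m ≤ 2 * N) (q g : ℝ → ℝ) (hq : ContDiff ℝ 1 q)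
    (hp : Function.Periodic q (2 * Real.pi)) (G : ℝ) (hG : ∀ x, |g x| ≤ G)
    (hT : IsTrigPoly (2 * (N / 3)) (fun x => (q x : ℂ) - (g x : ℝ)))
    (v : ℝ → ℂ) (hv : IsTrigPoly m v) :
    ‖∫ x in (0 : ℝ)..(2 * Real.pi),
          (starRingEnd ℂ) (v x) * deriv (fun y => AN N (fun z => (q z : ℂ) * v z) y) x‖
        ≤ 2 * G * N * ∫ x in (0 : ℝ)..(2 * Real.pi), ‖v x‖ ^ 2 := by
  obtain ⟨c, rfl⟩ := itp_iff.1 hv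
  set s := Finset.Icc (-(m : ℤ)) (m : ℤ) with hs
  set v := tp s c with hvdef
  have hN0 : (0 : ℝ) < N := by exact_mod_cast hN
  have hpi := Real.pi_pos
  have hG0 : 0 ≤ G := (abs_nonneg _).trans (hG 0)
  have hqc : ContDiff ℝ 1 (fun x => (q x : ℂ)) := Complex.ofRealCLM.contDiff.comp hq
  have hgc : ContDiff ℝ 1 (fun x => (g x : ℂ)) := by
    have := hqc.sub (itp_contDiff hT 1)
    simpa using this
  have hgp : Function.Periodic (fun x => (g x : ℂ)) (2 * Real.pi) := by
    intro x
    have := itp_per hT x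
    simp only [hp x] at this
    exact sub_right_inj.1 this
  have hvc : Continuous v := tp_cont _ _
  set f : ℝ → ℂ := fun x => (g x : ℂ) * v x with hf
  have hfd : ContDiff ℝ 1 f := hgc.mul (tp_contDiff _ _ _)
  have hfp : Function.Periodic f (2 * Real.pi) := by
    intro x
    have h1 : v (x + 2 * Real.pi) = v x := tp_periodic s c x
    have h2 : (g (x + 2 * Real.pi) : ℂ) = g x := hgp x
    simp only [hf]
    rw [h1, h2]
  set w : ℤ → ℂ := fun k => -(Complex.I * k) * c k with hw
  set L := 2 * N + 1 with hL
  have hL0 : (0 : ℝ) < L := by positivity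
  -- alias coefficients
  have halias : ∀ k ∈ s, aliasC N (fun z => (q z : ℂ) * v z) k
      = (1 / (L : ℂ)) * ∑ n ∈ Finset.range L, f (xs L n) * ee (-k) (xs L n) - fc f k := by
    intro k hk
    have h1 := hasSum_ite_sub_hasSum (sampling f hfd hfp L (by omega) k) 0
    rw [zero_mul, add_zero] at h1
    rw [← h1.tsum_eq]
    unfold aliasC
    refine tsum_congr fun l => ?_
    by_cases hl : l = 0
    · simp [hl]
    · simp only [ne_eq, hl, not_false_eq_true, if_true, if_false]
      rw [show (2 * (N : ℤ) + 1) = (L : ℤ) by rw [hL]; push_cast; rfl]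
      have e : (fun z => (q z : ℂ) * v z) = fun z => f z + ((q z : ℂ) - (g z : ℝ)) * v z := by
        funext z; simp only [hf]; ring
      have hTv := itp_mul hT hv
      rw [e, fc_add hfd.continuous (itp_contDiff hTv 0).continuous, fc_itp hTv, add_zero]
      rw [hs, Finset.mem_Icc] at hk
      rw [lt_abs]
      push_cast
      rcases lt_or_gt_of_ne hl with h | h
      · right
        have : l * (L : ℤ) ≤ -1 * L := by
          apply mul_le_mul_of_nonneg_right (by omega); omega
        omega
      · left
        have : 1 * (L : ℤ) ≤ l * L := by
          apply mul_le_mul_of_nonneg_right (by omega); omega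
        omega
  -- the integral as a sum
  have hderiv : ∀ x, deriv (fun y => AN N (fun z => (q z : ℂ) * v z) y) x
      = tp (Finset.Icc (-(N : ℤ)) (N : ℤ))
        (fun k => Complex.I * k * aliasC N (fun z => (q z : ℂ) * v z) k) x :=
    fun x => (tp_hasDerivAt _ _ x).deriv
  simp only [hderiv]
  rw [int_conj _ _ _ (tp_cont _ _)]
  have hmain : (2 * Real.pi : ℂ) * ∑ k ∈ s, (starRingEnd ℂ) (c k) * fc (tp (Finset.Icc (-(N : ℤ)) (N : ℤ))
        (fun k => Complex.I * k * aliasC N (fun z => (q z : ℂ) * v z) k)) k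
      = (2 * Real.pi : ℂ) * ((1 / (L : ℂ)) * ∑ n ∈ Finset.range L,
          (starRingEnd ℂ) (tp s w (xs L n)) * f (xs L n))
        - ∫ x in (0 : ℝ)..(2 * Real.pi), (starRingEnd ℂ) (tp s w x) * f x := by
    rw [int_conj _ _ _ hfd.continuous, ← mul_sub]
    congr 1
    simp only [tp_conj, Finset.sum_mul]
    rw [Finset.sum_comm, Finset.mul_sum, ← Finset.sum_sub_distrib]
    refine Finset.sum_congr rfl fun k hk => ?_
    rw [fc_tp, if_pos, halias k hk]
    · have : (starRingEnd ℂ) (w k) = Complex.I * k * (starRingEnd ℂ) (c k) := by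
        simp [hw]
      rw [this]
      simp only [Finset.mul_sum, mul_sub]
      congr 1
      · exact Finset.sum_congr rfl fun n _ => by ring
      · ring
    · rw [hs, Finset.mem_Icc] at hk
      rw [Finset.mem_Icc]; omega
  rw [hmain]
  -- bounds
  set V := ∑ k ∈ s, ‖c k‖ ^ 2 with hV
  set W := ∑ k ∈ s, ‖w k‖ ^ 2 with hW
  have hWV : W ≤ (N : ℝ) ^ 2 * V := by
    rw [hW, hV, Finset.mul_sum]
    refine Finset.sum_le_sum fun k hk => ?_
    simp only [hw, norm_mul, norm_neg, Complex.norm_I, one_mul, Complex.norm_intCast, mul_pow]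
    gcongr
    rw [hs, Finset.mem_Icc] at hk
    have : |k| ≤ (N : ℤ) := by rw [abs_le]; omega
    exact_mod_cast this
  have hVW : (N * V + W / N) / 2 ≤ N * V := by
    have : W / N ≤ N * V := by
      rw [div_le_iff₀ hN0]; linarith
    linarith
  have hpt : ∀ x, ‖(starRingEnd ℂ) (tp s w x) * f x‖
      ≤ G * ((N * ‖v x‖ ^ 2 + ‖tp s w x‖ ^ 2 / N) / 2) := by
    intro x
    simp only [hf, norm_mul, RCLike.norm_conj, Complex.norm_real, Real.norm_eq_abs]
    calc ‖tp s w x‖ * (|g x| * ‖v x‖) = |g x| * (‖v x‖ * ‖tp s w x‖) := by ring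
      _ ≤ G * (‖v x‖ * ‖tp s w x‖) := by gcongr; exact hG x
      _ ≤ _ := by gcongr; exact amgm hN0
  have hm2 : 2 * m < L := by omega
  have b1 : ‖∑ n ∈ Finset.range L, (starRingEnd ℂ) (tp s w (xs L n)) * f (xs L n)‖
      ≤ G * (L * (N * V)) := by
    refine (norm_sum_le _ _).trans ((Finset.sum_le_sum fun n _ => hpt (xs L n)).trans ?_)
    rw [← Finset.mul_sum, ← Finset.sum_div, Finset.sum_add_distrib, ← Finset.mul_sum,
      ← Finset.sum_div, hvdef, disc_parseval L m hm2, disc_parseval L m hm2]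
    have : (N * (L * V) + L * W / N) / 2 ≤ L * (N * V) := by
      have := mul_le_mul_of_nonneg_left hVW hL0.le
      calc _ = L * ((N * V + W / N) / 2) := by ring
        _ ≤ _ := this
    gcongr
  have b2 : ‖∫ x in (0 : ℝ)..(2 * Real.pi), (starRingEnd ℂ) (tp s w x) * f x‖
      ≤ G * (2 * Real.pi * (N * V)) := by
    have hwc : Continuous (tp s w) := tp_cont _ _
    refine (intervalIntegral.norm_integral_le_of_norm_le (by positivity)
      (Filter.Eventually.of_forall fun x _ => hpt x)
      (Continuous.intervalIntegrable (by fun_prop) _ _)).trans ?_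
    rw [intervalIntegral.integral_const_mul, intervalIntegral.integral_div,
      intervalIntegral.integral_add (Continuous.intervalIntegrable (by fun_prop) _ _)
      (Continuous.intervalIntegrable (by fun_prop) _ _), intervalIntegral.integral_const_mul,
      intervalIntegral.integral_div, hvdef, parseval, parseval]
    have : (N * (2 * Real.pi * V) + 2 * Real.pi * W / N) / 2 ≤ 2 * Real.pi * (N * V) := by
      have := mul_le_mul_of_nonneg_left hVW (by positivity : 0 ≤ 2 * Real.pi)
      calc _ = 2 * Real.pi * ((N * V + W / N) / 2) := by ring
        _ ≤ _ := this
    gcongr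
  refine (norm_sub_le _ _).trans ?_
  rw [hvdef, parseval]
  have b3 : ‖(2 * Real.pi : ℂ) * ((1 / (L : ℂ)) * ∑ n ∈ Finset.range L,
          (starRingEnd ℂ) (tp s w (xs L n)) * f (xs L n))‖ ≤ G * (2 * Real.pi * (N * V)) := by
    have n1 : ‖(2 * Real.pi : ℂ)‖ = 2 * Real.pi := by
      rw [norm_mul, Complex.norm_real, Real.norm_of_nonneg hpi.le]; simp
    have n2 : ‖(1 / (L : ℂ))‖ = 1 / L := by simp
    rw [norm_mul, n1, norm_mul, n2]
    calc _ ≤ 2 * Real.pi * (1 / L * (G * (L * (N * V)))) := by gcongr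
      _ = _ := by field_simp
  calc _ ≤ G * (2 * Real.pi * (N * V)) + G * (2 * Real.pi * (N * V)) := add_le_add b3 b2
    _ = _ := by rw [hV]; ring

/-- **De-aliasing bound for the 2/3 method.**
If `v = S u_N` is a trigonometric polynomial whose modes are confined to `|k| ≤ 2N/3`
(the output of a smoothing operator acting only there) and `q ∈ C^r` with `r ≥ 1`
(with all derivatives up to order `r` bounded by `M`), then
`|∫ v ∂_x A_N[q v] dx| ≤ C ‖q‖_{C^r} N^{1−r} ‖v‖²_{L²}`. -/
theorem stmt_6 (r : ℕ) (hr : 1 ≤ r) :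
    ∃ C > 0, ∀ (N m : ℕ), 1 ≤ N → 3 * m ≤ 2 * N →
      ∀ (q : ℝ → ℝ), ContDiff ℝ r q → Function.Periodic q (2 * Real.pi) →
      ∀ M : ℝ, (∀ i ≤ r, ∀ x : ℝ, |iteratedDeriv i q x| ≤ M) →
      ∀ v : ℝ → ℂ, IsTrigPoly m v →
      ‖∫ x in (0 : ℝ)..(2 * Real.pi),
          (starRingEnd ℂ) (v x) * deriv (fun y => AN N (fun z => (q z : ℂ) * v z) y) x‖
        ≤ C * M * (N : ℝ) ^ ((1 : ℝ) - r) * ∫ x in (0 : ℝ)..(2 * Real.pi), ‖v x‖ ^ 2 := by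
  refine ⟨2 * 39 ^ r, by positivity, ?_⟩
  intro N m hN hm q hq hp M hM v hv
  obtain ⟨g, hg, hT⟩ := jackson r N hN q hq hp M (hM r le_rfl)
  have hq1 : ContDiff ℝ 1 q := hq.of_le (by exact_mod_cast hr)
  refine (core N m hN hm q g hq1 hp _ hg hT v hv).trans (le_of_eq ?_)
  have hN0 : (0 : ℝ) < N := by exact_mod_cast hN
  rw [Real.rpow_sub hN0, Real.rpow_one, Real.rpow_natCast, div_pow]
  ring
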